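/- For all i,j ≥ −1, the following four formulas are derivable in Int: (1) C_2 ∧ B_i^1 → C_2 ∧ Q_{i,j}; (2) C_2 ∧ A_i^1 → C_2 ∧ P_{i,j}; (3) C_1 ∨ P_{i,j} → (C_2 → C_1 ∨ A_i^1 ∨ B_{i−1}^1); (4) C_1 ∨ Q_{i,j} → (C_2 → C_1 ∨ A_{i−1}^1 ∨ B_i^1). -/

import Mathlib

namespace Paper

/-- Propositional formulas over variables indexed by ℕ, with ⊥, ∧, ∨, →. -/
inductive Fml : Type
  | var : ℕ → Fml
  | bot : Fml
  | and : Fml → Fml → Fml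
  | or : Fml → Fml → Fml
  | imp : Fml → Fml → Fml

namespace Fml

/-- ¬A := A → ⊥ -/
def neg (A : Fml) : Fml := A.imp bot

/-- A ↔ B := (A → B) ∧ (B → A) -/
def biimp (A B : Fml) : Fml := (A.imp B).and (B.imp A)

/-- The three fixed distinct variables p, q, r. -/
def p : Fml := var 0
def q : Fml := var 1
def r : Fml := var 2

/-- Applying a substitution σ to a formula. -/
def subst (σ : ℕ → Fml) : Fml → Fml
  | var n => σ n
  | bot => bot
  | and A B => and (subst σ A) (subst σ B)
  | or A B => or (subst σ A) (subst σ B)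
  | imp A B => imp (subst σ A) (subst σ B)

/-- The set of variables occurring in a formula. -/
def vars : Fml → Finset ℕ
  | var n => {n}
  | bot => ∅
  | and A B => A.vars ∪ B.vars
  | or A B => A.vars ∪ B.vars
  | imp A B => A.vars ∪ B.vars

/-- An injective encoding of formulas into ℕ. -/
def encode : Fml → ℕ
  | var n => 5 * n
  | bot => 1
  | and A B => 5 * Nat.pair A.encode B.encode + 2
  | or A B => 5 * Nat.pair A.encode B.encode + 3
  | imp A B => 5 * Nat.pair A.encode B.encode + 4

end Fml

open Fml

/-- The standard axioms of the intuitionistic propositional calculus Int. -/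
def IntAx : Set Fml :=
  { p.imp (q.imp p),
    (p.imp (q.imp r)).imp ((p.imp q).imp (p.imp r)),
    (p.and q).imp p,
    (p.and q).imp q,
    p.imp (q.imp (p.and q)),
    p.imp (p.or q),
    q.imp (p.or q),
    (p.imp r).imp ((q.imp r).imp ((p.or q).imp r)),
    (p.imp q).imp ((p.imp q.neg).imp p.neg),
    p.imp (p.neg.imp q) }

/-- Derivability in Int extended with the extra axioms Γ, with rules
    modus ponens and substitution.  `Deriv ∅ A` is `Int ⊢ A`;
    `Deriv {B} A` is `Int + B ⊢ A`. -/
inductive Deriv (Γ : Set Fml) : Fml → Prop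
  | ax {A : Fml} : A ∈ IntAx → Deriv Γ A
  | extra {A : Fml} : A ∈ Γ → Deriv Γ A
  | mp {A B : Fml} : Deriv Γ (A.imp B) → Deriv Γ A → Deriv Γ B
  | subst {A : Fml} (σ : ℕ → Fml) : Deriv Γ A → Deriv Γ (A.subst σ)

/-- (S,T) pair: `ST x n = (S_{n-2}[x], T_{n-2}[x])` (index shifted by 2). -/
def ST (x : Fml) : ℕ → Fml × Fml
  | 0 => (x.neg, x.neg.neg)
  | 1 =>
      let s := Fml.imp x.neg.neg x
      (s, s.imp (Fml.or x.neg x.neg.neg))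
  | (n+2) =>
      let st1 := ST x (n+1)
      let st0 := ST x n
      let s := st1.2.imp (st1.1.or st0.2)
      (s, s.imp (st1.1.or st1.2))

def Sf (x : Fml) (n : ℕ) : Fml := (ST x n).1
def Tf (x : Fml) (n : ℕ) : Fml := (ST x n).2

/-- `A0 n = A_{n-5}^0 = S_{n-2}[r]`, `B0 n = B_{n-5}^0` (index shifted by 5). -/
def A0 (n : ℕ) : Fml := Sf r n
def B0 (n : ℕ) : Fml := Tf r n

def C1 : Fml := A0 5
def C2 : Fml := B0 5

/-- Generic groups (A^1),(B^1) / (A^2),(B^2): `AB v c1 c2 n = (A_{n-5}, B_{n-5})`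
    built over the variable `v` (index shifted by 5). -/
def AB (v c1 c2 : Fml) : ℕ → Fml × Fml
  | 0 => (Sf v 0, Tf v 0)
  | 1 => (Sf v 1, Tf v 1)
  | 2 => (Sf v 2, Tf v 2)
  | 3 =>
      let x2 := AB v c1 c2 2
      let x1 := AB v c1 c2 1
      (x2.2.imp (x2.1.or x1.2), x2.1.imp (c1.or x2.2))
  | 4 =>
      let x3 := AB v c1 c2 3
      let x2 := AB v c1 c2 2
      (x3.2.imp (x3.1.or x2.2), x3.1.imp (x2.1.or x3.2))
  | (n+5) =>
      let x1 := AB v c1 c2 (n+4)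
      let x0 := AB v c1 c2 (n+3)
      ((c2.and x1.2).imp (c1.or (x1.1.or x0.2)),
       (c2.and x1.1).imp (c1.or (x0.1.or x1.2)))

/-- `A1 n = A_{n-5}^1` etc. (index shifted by 5). -/
def A1 (n : ℕ) : Fml := (AB p C1 C2 n).1
def B1 (n : ℕ) : Fml := (AB p C1 C2 n).2
def A2 (n : ℕ) : Fml := (AB q C2 C1 n).1
def B2 (n : ℕ) : Fml := (AB q C2 C1 n).2

/-- `AF j` is the family A^j, `BF j` the family B^j (ℕ-index shifted by 5). -/
def AF : Fin 3 → ℕ → Fml := ![A0, A1, A2]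
def BF : Fin 3 → ℕ → Fml := ![B0, B1, B2]

/-- The code E_{s,m,n} of a configuration (s,m,n). -/
def Efml (s m n : ℕ) : Fml :=
  ((A0 (3*s+7)).and ((B0 (3*s+7)).and ((A1 (m+6)).and ((B1 (m+6)).and
      ((A2 (n+6)).and (B2 (n+6))))))).imp
  ((A0 (3*s+6)).or ((B0 (3*s+6)).or ((A1 (m+5)).or ((B1 (m+5)).or
      ((A2 (n+5)).or (B2 (n+5)))))))

/-- `FG x y k = (F_k[p,q,x,y], G_k[p,q,x,y])`. -/
def FG (x y : Fml) : ℕ → Fml × Fml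
  | 0 => (p, q)
  | 1 => ((y.and q).imp (x.or p), (y.and p).imp (x.or q))
  | (k+2) =>
      let fg1 := FG x y (k+1)
      let fg0 := FG x y k
      ((y.and fg1.2).imp (x.or (fg1.1.or fg0.2)),
       (y.and fg1.1).imp (x.or (fg1.2.or fg0.1)))

/-- Key formulas F_k^1, G_k^1, F_k^2, G_k^2 (as formulas in p,q,r). -/
def F1k (k : ℕ) : Fml := (FG C1 C2 k).1
def G1k (k : ℕ) : Fml := (FG C1 C2 k).2
def F2k (k : ℕ) : Fml := (FG C2 C1 k).1
def G2k (k : ℕ) : Fml := (FG C2 C1 k).2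

/-- Substituting X for p and Y for q. -/
def sub2 (X Y : Fml) (A : Fml) : Fml :=
  A.subst (fun n => if n = 0 then X else if n = 1 then Y else var n)

/-- `Pf a b = P_{a-1,b-1}` (indices shifted by 1, so defined for all a,b:ℕ, i.e. i,j ≥ -1). -/
def Pf (a b : ℕ) : Fml :=
  (C2.imp (C1.or ((A1 (a+4)).or (B1 (a+3))))).and
  (C1.imp (C2.or ((A2 (b+4)).or (B2 (b+3)))))

/-- `Qf a b = Q_{a-1,b-1}` (indices shifted by 1). -/
def Qf (a b : ℕ) : Fml :=
  (C2.imp (C1.or ((A1 (a+3)).or (B1 (a+4))))).and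
  (C1.imp (C2.or ((A2 (b+3)).or (B2 (b+4)))))

/-- Ê_{s,i,j} (intended for i,j ≥ 1). -/
def Ehat (s i j : ℕ) : Fml :=
  ((A0 (3*s+7)).and ((B0 (3*s+7)).and ((F1k (i+1)).and ((G1k (i+1)).and
      ((F2k (j+1)).and (G2k (j+1))))))).imp
  ((A0 (3*s+6)).or ((B0 (3*s+6)).or ((F1k i).or ((G1k i).or
      ((F2k j).or (G2k j))))))

/-- Ê_{s,0,*}. -/
def Ehat0star (s : ℕ) : Fml :=
  ((A0 (3*s+7)).and ((B0 (3*s+7)).and ((A1 6).and (B1 6)))).imp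
  ((A0 (3*s+6)).or ((B0 (3*s+6)).or ((A1 5).or ((B1 5).or q))))

/-- Ê_{s,*,0}. -/
def Ehatstar0 (s : ℕ) : Fml :=
  ((A0 (3*s+7)).and ((B0 (3*s+7)).and ((A2 6).and (B2 6)))).imp
  ((A0 (3*s+6)).or ((B0 (3*s+6)).or (p.or ((A2 5).or (B2 5)))))

/-! ### Minsky machines -/

/-- Configurations (s, m, n). -/
abbrev Cfg := ℕ × ℕ × ℕ

/-- The four forms of Minsky machine instructions. -/
inductive MInstr : Type
  | inc1 (s t : ℕ)                -- s ↦ (t,1,0)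
  | inc2 (s t : ℕ)                -- s ↦ (t,0,1)
  | dec1 (s t u : ℕ)              -- s ↦ (t,-1,0)/(u,0,0)
  | dec2 (s t u : ℕ)              -- s ↦ (t,0,-1)/(u,0,0)
deriving DecidableEq

def MInstr.state : MInstr → ℕ
  | inc1 s _ => s
  | inc2 s _ => s
  | dec1 s _ _ => s
  | dec2 s _ _ => s

/-- One application of an instruction to a configuration. -/
def MInstr.step : MInstr → Cfg → Cfg → Prop
  | inc1 s t, c, c' => ∃ m n, c = (s, m, n) ∧ c' = (t, m + 1, n)
  | inc2 s t, c, c' => ∃ m n, c = (s, m, n) ∧ c' = (t, m, n + 1)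
  | dec1 s t u, c, c' => ∃ m n, c = (s, m, n) ∧
      ((0 < m ∧ c' = (t, m - 1, n)) ∨ (m = 0 ∧ c' = (u, 0, n)))
  | dec2 s t u, c, c' => ∃ m n, c = (s, m, n) ∧
      ((0 < n ∧ c' = (t, m, n - 1)) ∨ (n = 0 ∧ c' = (u, m, 0)))

/-- A Minsky machine: a finite deterministic set of instructions. -/
structure Minsky where
  instrs : List MInstr
  det : ∀ I ∈ instrs, ∀ J ∈ instrs, I.state = J.state → I = J

/-- One step of the machine. -/
def Minsky.Step (M : Minsky) (c c' : Cfg) : Prop := ∃ I ∈ M.instrs, I.step c c'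

/-- (s,m,n) ⟹_𝓜 (t,k,l): reachability in finitely many (possibly zero) steps. -/
def Minsky.Reach (M : Minsky) : Cfg → Cfg → Prop := Relation.ReflTransGen M.Step

/-- The formula Ax(I) simulating an instruction I. -/
def AxI : MInstr → Fml
  | .inc1 s t => (Ehat t 2 1).imp (Ehat s 1 1)
  | .inc2 s t => (Ehat t 1 2).imp (Ehat s 1 1)
  | .dec1 s t u => ((Ehat t 1 1).imp (Ehat s 2 1)).and ((Ehat0star u).imp (Ehat0star s))
  | .dec2 s t u => ((Ehat t 1 1).imp (Ehat s 1 2)).and ((Ehatstar0 u).imp (Ehatstar0 s))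

/-- The formula Ax(𝓜): the conjunction of Ax(I) over all instructions of 𝓜. -/
def AxM (M : Minsky) : Fml := M.instrs.foldr (fun I acc => (AxI I).and acc) Fml.bot.neg

/-! ### Kripke semantics and the frame 𝔉 -/

/-- Intuitionistic forcing over an arbitrary accessibility relation R and valuation V. -/
def Force {α : Type} (R : α → α → Prop) (V : ℕ → α → Prop) : α → Fml → Prop
  | w, Fml.var n => V n w
  | _, Fml.bot => False
  | w, Fml.and A B => Force R V w A ∧ Force R V w B
  | w, Fml.or A B => Force R V w A ∨ Force R V w B
  | w, Fml.imp A B => ∀ w', R w w' → Force R V w' A → Force R V w' B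

/-- A valuation is R-upward-closed. -/
def UpClosed {α : Type} (R : α → α → Prop) (V : ℕ → α → Prop) : Prop :=
  ∀ n w w', V n w → R w w' → V n w'

/-- The equivalence ∼_𝓜: mutual reachability. -/
def MEquiv (M : Minsky) : Setoid Cfg where
  r c c' := M.Reach c c' ∧ M.Reach c' c
  iseqv := ⟨fun _ => ⟨Relation.ReflTransGen.refl, Relation.ReflTransGen.refl⟩,
    fun h => ⟨h.2, h.1⟩, fun h h' => ⟨h.1.trans h'.1, h'.2.trans h.2⟩⟩

/-- Equivalence classes of configurations. -/
def Cl (M : Minsky) := Quotient (MEquiv M)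

/-- The class [c] of a configuration c. -/
def cl (M : Minsky) (c : Cfg) : Cl M := Quotient.mk (MEquiv M) c

/-- ⟹_𝓜 lifted to equivalence classes. -/
def ClReach (M : Minsky) (α β : Cl M) : Prop :=
  ∃ c c', cl M c = α ∧ cl M c' = β ∧ M.Reach c c'

/-- Raw points: a_i^j, b_i^j (ℕ-index n = i+5, so i ≥ -5) and e_α. -/
inductive Pt (M : Minsky) : Type
  | a (j : Fin 3) (n : ℕ)
  | b (j : Fin 3) (n : ℕ)
  | e (α : Cl M)

/-- The immediate-accessibility relation R' of the frame 𝔉 (on raw points). -/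
inductive Edge (M : Minsky) (c0 : Cfg) : Pt M → Pt M → Prop
  | a4a5 (j : Fin 3) : Edge M c0 (.a j 1) (.a j 0)
  | b4a5 (j : Fin 3) : Edge M c0 (.b j 1) (.a j 0)
  | b4b5 (j : Fin 3) : Edge M c0 (.b j 1) (.b j 0)
  | a3a4 (j : Fin 3) : Edge M c0 (.a j 2) (.a j 1)
  | a3b5 (j : Fin 3) : Edge M c0 (.a j 2) (.b j 0)
  | b3a4 (j : Fin 3) : Edge M c0 (.b j 2) (.a j 1)
  | b3b4 (j : Fin 3) : Edge M c0 (.b j 2) (.b j 1)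
  -- group j = 0, i ≥ -2:
  | a0a (n : ℕ) : Edge M c0 (.a 0 (n+3)) (.a 0 (n+2))
  | a0b (n : ℕ) : Edge M c0 (.a 0 (n+3)) (.b 0 (n+1))
  | b0a (n : ℕ) : Edge M c0 (.b 0 (n+3)) (.a 0 (n+2))
  | b0b (n : ℕ) : Edge M c0 (.b 0 (n+3)) (.b 0 (n+2))
  -- groups j = 1,2 at i = -2:
  | am2a (j : Fin 3) (h : j ≠ 0) : Edge M c0 (.a j 3) (.a j 2)
  | am2b (j : Fin 3) (h : j ≠ 0) : Edge M c0 (.a j 3) (.b j 1)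
  | bm2each1 : Edge M c0 (.b 1 3) (.a 0 5)
  | bm2b1 : Edge M c0 (.b 1 3) (.b 1 2)
  | bm2each2 : Edge M c0 (.b 2 3) (.b 0 5)
  | bm2b2 : Edge M c0 (.b 2 3) (.b 2 2)
  -- groups j = 1,2, i ≥ -1:
  | aja (j : Fin 3) (h : j ≠ 0) (n : ℕ) : Edge M c0 (.a j (n+4)) (.a j (n+3))
  | ajb (j : Fin 3) (h : j ≠ 0) (n : ℕ) : Edge M c0 (.a j (n+4)) (.b j (n+2))
  | bja (j : Fin 3) (h : j ≠ 0) (n : ℕ) : Edge M c0 (.b j (n+4)) (.a j (n+2))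
  | bjb (j : Fin 3) (h : j ≠ 0) (n : ℕ) : Edge M c0 (.b j (n+4)) (.b j (n+3))
  -- group R_{s,m,n}:
  | e1 (s m n : ℕ) (h : M.Reach c0 (s,m,n)) : Edge M c0 (.e (cl M (s,m,n))) (.a 0 (3*s+6))
  | e2 (s m n : ℕ) (h : M.Reach c0 (s,m,n)) : Edge M c0 (.e (cl M (s,m,n))) (.b 0 (3*s+6))
  | e3 (s m n : ℕ) (h : M.Reach c0 (s,m,n)) : Edge M c0 (.e (cl M (s,m,n))) (.a 1 (m+5))
  | e4 (s m n : ℕ) (h : M.Reach c0 (s,m,n)) : Edge M c0 (.e (cl M (s,m,n))) (.b 1 (m+5))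
  | e5 (s m n : ℕ) (h : M.Reach c0 (s,m,n)) : Edge M c0 (.e (cl M (s,m,n))) (.a 2 (n+5))
  | e6 (s m n : ℕ) (h : M.Reach c0 (s,m,n)) : Edge M c0 (.e (cl M (s,m,n))) (.b 2 (n+5))
  -- (e_α, e_β) whenever α ⟹ β:
  | ee (c c' : Cfg) (h : M.Reach c c') : Edge M c0 (.e (cl M c)) (.e (cl M c'))

/-- Which raw points belong to the set of worlds W. -/
def Valid (M : Minsky) (c0 : Cfg) : Pt M → Prop
  | .e α => ClReach M (cl M c0) α
  | _ => True

/-- The set of worlds W of the frame 𝔉. -/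
def W (M : Minsky) (c0 : Cfg) := {x : Pt M // Valid M c0 x}

/-- The accessibility relation R of 𝔉: reflexive-transitive closure of R'. -/
def Rel (M : Minsky) (c0 : Cfg) : W M c0 → W M c0 → Prop :=
  Relation.ReflTransGen (fun x y => Edge M c0 x.1 y.1)

/-- The point a_{n-5}^j of W. -/
def aPt (M : Minsky) (c0 : Cfg) (j : Fin 3) (n : ℕ) : W M c0 := ⟨.a j n, trivial⟩

/-- The point b_{n-5}^j of W. -/
def bPt (M : Minsky) (c0 : Cfg) (j : Fin 3) (n : ℕ) : W M c0 := ⟨.b j n, trivial⟩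

/-- The point e_{[c]} of W (for a reachable configuration c). -/
def ePt (M : Minsky) (c0 : Cfg) (c : Cfg) (h : M.Reach c0 c) : W M c0 :=
  ⟨.e (cl M c), ⟨c0, c, rfl, rfl, h⟩⟩

/-- The valuation 𝔙 of the model 𝔐 (p = var 0 ↔ group 1, q = var 1 ↔ group 2,
    r = var 2 ↔ group 0). -/
def V0 (M : Minsky) (c0 : Cfg) : ℕ → W M c0 → Prop
  | 0, w => ¬ (Rel M c0 w (aPt M c0 1 1) ∨ Rel M c0 w (bPt M c0 1 0))
  | 1, w => ¬ (Rel M c0 w (aPt M c0 2 1) ∨ Rel M c0 w (bPt M c0 2 0))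
  | 2, w => ¬ (Rel M c0 w (aPt M c0 0 1) ∨ Rel M c0 w (bPt M c0 0 0))
  | _, _ => True

end Paper

namespace Paper

open Fml

namespace Deriv

variable {Γ : Set Fml} {A B C D H : Fml}

/-- The substitution sending `p`, `q`, `r` to `A`, `B`, `C` respectively. -/
def inst (A B C : Fml) : ℕ → Fml
  | 0 => A
  | 1 => B
  | _ => C

theorem imp_intro_const (A B : Fml) : Deriv Γ (A.imp (B.imp A)) :=
  (Deriv.ax (A := p.imp (q.imp p)) (by simp [IntAx])).subst (inst A B A)

theorem imp_distrib (A B C : Fml) :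
    Deriv Γ ((A.imp (B.imp C)).imp ((A.imp B).imp (A.imp C))) :=
  (Deriv.ax (A := (p.imp (q.imp r)).imp ((p.imp q).imp (p.imp r)))
    (by simp [IntAx])).subst (inst A B C)

theorem and_left (A B : Fml) : Deriv Γ ((A.and B).imp A) :=
  (Deriv.ax (A := (p.and q).imp p) (by simp [IntAx])).subst (inst A B A)

theorem and_right (A B : Fml) : Deriv Γ ((A.and B).imp B) :=
  (Deriv.ax (A := (p.and q).imp q) (by simp [IntAx])).subst (inst A B A)

theorem and_mk (A B : Fml) : Deriv Γ (A.imp (B.imp (A.and B))) :=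
  (Deriv.ax (A := p.imp (q.imp (p.and q))) (by simp [IntAx])).subst (inst A B A)

theorem or_inl (A B : Fml) : Deriv Γ (A.imp (A.or B)) :=
  (Deriv.ax (A := p.imp (p.or q)) (by simp [IntAx])).subst (inst A B A)

theorem or_inr (A B : Fml) : Deriv Γ (B.imp (A.or B)) :=
  (Deriv.ax (A := q.imp (p.or q)) (by simp [IntAx])).subst (inst A B A)

theorem or_cases (A B C : Fml) :
    Deriv Γ ((A.imp C).imp ((B.imp C).imp ((A.or B).imp C))) :=
  (Deriv.ax (A := (p.imp r).imp ((q.imp r).imp ((p.or q).imp r)))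
    (by simp [IntAx])).subst (inst A B C)

theorem weaken (H : Fml) (h : Deriv Γ A) : Deriv Γ (H.imp A) :=
  (imp_intro_const A H).mp h

/-- Modus ponens under a hypothesis. -/
theorem mp_under (h : Deriv Γ (H.imp (A.imp B))) (h' : Deriv Γ (H.imp A)) :
    Deriv Γ (H.imp B) :=
  ((imp_distrib H A B).mp h).mp h'

theorem trans (h : Deriv Γ (A.imp B)) (h' : Deriv Γ (B.imp C)) : Deriv Γ (A.imp C) :=
  mp_under (weaken A h') h

theorem imp_const (h : Deriv Γ (H.imp A)) (B : Fml) : Deriv Γ (H.imp (B.imp A)) :=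
  trans h (imp_intro_const A B)

theorem imp_and (h : Deriv Γ (H.imp A)) (h' : Deriv Γ (H.imp B)) :
    Deriv Γ (H.imp (A.and B)) :=
  mp_under (trans h (and_mk A B)) h'

theorem or_imp (h : Deriv Γ (A.imp C)) (h' : Deriv Γ (B.imp C)) :
    Deriv Γ ((A.or B).imp C) :=
  ((or_cases A B C).mp h).mp h'

/-- If `B` implies `D`, then `C ∧ B` implies `C` together with `A → D` and
`A' → C ∨ E` for any `A`, `A'`, `E`. -/
theorem and_imp_and_imp_and_imp_or (A A' E : Fml) (h : Deriv Γ (B.imp D)) :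
    Deriv Γ ((C.and B).imp (C.and ((A.imp D).and (A'.imp (C.or E))))) :=
  imp_and (and_left C B) <| imp_and
    (imp_const (trans (and_right C B) h) A)
    (imp_const (trans (and_left C B) (or_inl C E)) A')

theorem or_and_imp (A B D E : Fml) :
    Deriv Γ ((A.or ((B.imp (A.or D)).and E)).imp (B.imp (A.or D))) :=
  or_imp (imp_const (or_inl A D) B) (and_left _ E)

end Deriv

end Paper

open Paper in
/-- for all i,j ≥ -1 (ℕ-indices a = i+1, b = j+1), Int derives
    (1) C₂∧B_i^1 → C₂∧Q_{i,j};  (2) C₂∧A_i^1 → C₂∧P_{i,j};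
    (3) C₁∨P_{i,j} → (C₂ → C₁∨A_i^1∨B_{i-1}^1);
    (4) C₁∨Q_{i,j} → (C₂ → C₁∨A_{i-1}^1∨B_i^1). -/
theorem statement12 (a b : ℕ) :
    Deriv ∅ ((C2.and (B1 (a+4))).imp (C2.and (Qf a b))) ∧
    Deriv ∅ ((C2.and (A1 (a+4))).imp (C2.and (Pf a b))) ∧
    Deriv ∅ ((C1.or (Pf a b)).imp (C2.imp (C1.or ((A1 (a+4)).or (B1 (a+3)))))) ∧
    Deriv ∅ ((C1.or (Qf a b)).imp (C2.imp (C1.or ((A1 (a+3)).or (B1 (a+4)))))) := by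
  exact ⟨Deriv.and_imp_and_imp_and_imp_or _ _ _
      (Deriv.trans (Deriv.or_inr _ _) (Deriv.or_inr _ _)),
    Deriv.and_imp_and_imp_and_imp_or _ _ _
      (Deriv.trans (Deriv.or_inl _ _) (Deriv.or_inr _ _)),
    Deriv.or_and_imp _ _ _ _, Deriv.or_and_imp _ _ _ _⟩
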